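/- arXiv:1601.01853 — 9 statements merged into one kernel-verified Lean document; each statement's English description precedes it below -/
import Mathlib

section
/- Let α, k, ε be real numbers with k > 0, |α| < k, ε ≥ 0, set ω₀ = √(k² − α²)/2, and assume εω₀ < 1. Define T = (2π + arcsin(−α/k))/(1 − εω₀). Then the pair (ω, T) with ω = ω₀ satisfies exactly both characteristic equations 4k²cos(2εωT) + 16kω sin T sin(εωT) + 8αk sin T cos(εωT) − 16ω² + 4α² = 0 and −4k² sin(2εωT) − 8αk sin T sin(εωT) + 16kω sin T cos(εωT) + 16αω = 0; equivalently, λ = iω₀ is a root of (−λ − α/2 − (k/2)e^{−λεT} sin T)² + (k²/4)e^{−2λεT} cos² T = 0. -/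
/-- The critical delay `T_cr₁ = (2π + arcsin(−α/k))/(1 − εω₀)` of the delayed
Duffing slow flow is an exact root: with `ω = ω₀ = √(k²−α²)/2` both real
characteristic equations hold, and equivalently `λ = iω₀` is a root of the
complex characteristic equation. -/
theorem stmt_3 (α k ε : ℝ) (hk : k > 0) (hα : |α| < k) (hε : ε ≥ 0)
    (ω₀ : ℝ) (hω₀ : ω₀ = Real.sqrt (k^2 - α^2) / 2) (hεω : ε * ω₀ < 1)
    (T : ℝ) (hT : T = (2 * Real.pi + Real.arcsin (-α/k)) / (1 - ε * ω₀)) :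
    (4*k^2 * Real.cos (2*ε*ω₀*T) + 16*k*ω₀ * Real.sin T * Real.sin (ε*ω₀*T)
        + 8*α*k * Real.sin T * Real.cos (ε*ω₀*T) - 16*ω₀^2 + 4*α^2 = 0) ∧
    (-4*k^2 * Real.sin (2*ε*ω₀*T) - 8*α*k * Real.sin T * Real.sin (ε*ω₀*T)
        + 16*k*ω₀ * Real.sin T * Real.cos (ε*ω₀*T) + 16*α*ω₀ = 0) ∧
    ((-(Complex.I * (ω₀ : ℂ)) - (α : ℂ)/2
        - (k : ℂ)/2 * Complex.exp (-(Complex.I * (ω₀ : ℂ)) * (ε : ℂ) * (T : ℂ)) * (Real.sin T : ℂ))^2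
      + (k : ℂ)^2/4 * Complex.exp (-2 * (Complex.I * (ω₀ : ℂ)) * (ε : ℂ) * (T : ℂ)) * (Real.cos T : ℂ)^2
        = 0) := by
  have hk0 : k ≠ 0 := hk.ne'
  obtain ⟨hα₁, hα₂⟩ := abs_lt.mp hα
  have hd : 1 - ε * ω₀ ≠ 0 := by linarith
  set φ := Real.arcsin (-α / k) with hφ
  set θ := ε * ω₀ * T with hθ
  have hTθ : T = θ + φ + 2 * Real.pi := by
    rw [eq_div_iff hd] at hT
    rw [hθ]
    linarith
  have hsinT : Real.sin T = Real.sin θ * Real.cos φ + Real.cos θ * Real.sin φ := by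
    rw [hTθ, Real.sin_add_two_pi, Real.sin_add]
  have hcosT : Real.cos T = Real.cos θ * Real.cos φ - Real.sin θ * Real.sin φ := by
    rw [hTθ, Real.cos_add_two_pi, Real.cos_add]
  have hsin : Real.sin φ = -α / k := by
    apply Real.sin_arcsin
    · rw [le_div_iff₀ hk]; linarith
    · rw [div_le_iff₀ hk]; linarith
  have hcos : Real.cos φ = 2 * ω₀ / k := by
    have h : 1 - (-α / k) ^ 2 = (k ^ 2 - α ^ 2) / k ^ 2 := by field_simp
    rw [hφ, Real.cos_arcsin, h, Real.sqrt_div' _ (sq_nonneg k), Real.sqrt_sq hk.le, hω₀]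
    ring
  have hαφ : α = -k * Real.sin φ := by rw [hsin]; field_simp
  have hωφ : ω₀ = k * Real.cos φ / 2 := by rw [hcos]; field_simp
  have h2θ : 2 * ε * ω₀ * T = 2 * θ := by rw [hθ]; ring
  have hsqφ := Real.sin_sq_add_cos_sq φ
  have hsqθ := Real.sin_sq_add_cos_sq θ
  have hexp : Complex.exp (-(Complex.I * (ω₀ : ℂ)) * (ε : ℂ) * (T : ℂ))
      = (Real.cos θ : ℂ) - (Real.sin θ : ℂ) * Complex.I := by
    have h : -(Complex.I * (ω₀ : ℂ)) * (ε : ℂ) * (T : ℂ) = ((-θ : ℝ) : ℂ) * Complex.I := by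
      rw [hθ]; push_cast; ring
    rw [h, Complex.exp_mul_I, ← Complex.ofReal_cos, ← Complex.ofReal_sin, Real.cos_neg,
      Real.sin_neg]
    push_cast; ring
  have hexp2 : Complex.exp (-2 * (Complex.I * (ω₀ : ℂ)) * (ε : ℂ) * (T : ℂ))
      = ((Real.cos θ : ℂ) - (Real.sin θ : ℂ) * Complex.I) ^ 2 := by
    rw [← hexp, ← Complex.exp_nat_mul]
    congr 1; push_cast; ring
  rw [hexp, hexp2, h2θ, Real.cos_two_mul, Real.sin_two_mul, hsinT, hcosT]
  clear_value θ φ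
  clear hexp hexp2 hsinT hcosT
  generalize Real.sin φ = a at *
  generalize Real.cos φ = b at *
  generalize Real.sin θ = s at *
  generalize Real.cos θ = c at *
  have hb : b ^ 2 = 1 - a ^ 2 := by linarith
  have hs : s ^ 2 = 1 - c ^ 2 := by linarith
  rw [hαφ, hωφ]
  refine ⟨?_, ?_, ?_⟩
  · grind
  · grind
  · have hbC : (b : ℂ) ^ 2 = 1 - (a : ℂ) ^ 2 := by exact_mod_cast congrArg Complex.ofReal hb
    have hsC : (s : ℂ) ^ 2 = 1 - (c : ℂ) ^ 2 := by exact_mod_cast congrArg Complex.ofReal hs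
    have hI := Complex.I_sq
    push_cast
    generalize Complex.I = i at *
    generalize (a : ℂ) = a at *
    generalize (b : ℂ) = b at *
    generalize (s : ℂ) = s at *
    generalize (c : ℂ) = c at *
    generalize (k : ℂ) = k at *
    clear * - hbC hsC hI
    grind
end

section
/- Let α, k, ε be real numbers with k > 0, |α| < k, ε ≥ 0, and set ω₀ = √(k² − α²)/2. Define T = (π − arcsin(−α/k))/(1 + εω₀). Then the pair (ω, T) with ω = ω₀ satisfies exactly both characteristic equations 4k²cos(2εωT) + 16kω sin T sin(εωT) + 8αk sin T cos(εωT) − 16ω² + 4α² = 0 and −4k² sin(2εωT) − 8αk sin T sin(εωT) + 16kω sin T cos(εωT) + 16αω = 0; equivalently, λ = iω₀ is a root of (−λ − α/2 − (k/2)e^{−λεT} sin T)² + (k²/4)e^{−2λεT} cos² T = 0. -/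
/-- The critical delay `T_cr₂ = (π − arcsin(−α/k))/(1 + εω₀)` of the delayed
Duffing slow flow is an exact root: with `ω = ω₀ = √(k²−α²)/2` both real
characteristic equations hold, and equivalently `λ = iω₀` is a root of the
complex characteristic equation. -/
theorem stmt_4 (α k ε : ℝ) (hk : k > 0) (hα : |α| < k) (hε : ε ≥ 0)
    (ω₀ : ℝ) (hω₀ : ω₀ = Real.sqrt (k^2 - α^2) / 2)
    (T : ℝ) (hT : T = (Real.pi - Real.arcsin (-α/k)) / (1 + ε * ω₀)) :
    (4*k^2 * Real.cos (2*ε*ω₀*T) + 16*k*ω₀ * Real.sin T * Real.sin (ε*ω₀*T)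
        + 8*α*k * Real.sin T * Real.cos (ε*ω₀*T) - 16*ω₀^2 + 4*α^2 = 0) ∧
    (-4*k^2 * Real.sin (2*ε*ω₀*T) - 8*α*k * Real.sin T * Real.sin (ε*ω₀*T)
        + 16*k*ω₀ * Real.sin T * Real.cos (ε*ω₀*T) + 16*α*ω₀ = 0) ∧
    ((-(Complex.I * (ω₀ : ℂ)) - (α : ℂ)/2
        - (k : ℂ)/2 * Complex.exp (-(Complex.I * (ω₀ : ℂ)) * (ε : ℂ) * (T : ℂ)) * (Real.sin T : ℂ))^2
      + (k : ℂ)^2/4 * Complex.exp (-2 * (Complex.I * (ω₀ : ℂ)) * (ε : ℂ) * (T : ℂ)) * (Real.cos T : ℂ)^2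
        = 0) := by
  have hk0 : k ≠ 0 := hk.ne'
  obtain ⟨hlo, hhi⟩ := abs_lt.mp hα
  have hω_nonneg : 0 ≤ ω₀ := hω₀ ▸ by positivity
  have hden : 1 + ε * ω₀ ≠ 0 := by positivity
  have hsum : T + ε * ω₀ * T = Real.pi - Real.arcsin (-α / k) := by
    rw [hT]; field_simp
  have hS : Real.sin (T + ε * ω₀ * T) = -α / k := by
    rw [hsum, Real.sin_pi_sub, Real.sin_arcsin]
    · rw [le_div_iff₀ hk]; linarith
    · rw [div_le_iff₀ hk]; linarith
  have hC : Real.cos (T + ε * ω₀ * T) = -(2 * ω₀ / k) := by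
    have hsq : 1 - (-α / k) ^ 2 = (k ^ 2 - α ^ 2) / k ^ 2 := by field_simp
    rw [hsum, Real.cos_pi_sub, Real.cos_arcsin, hsq, Real.sqrt_div' _ (sq_nonneg k),
      Real.sqrt_sq hk.le, hω₀]
    ring
  have hα_eq : α = -k * Real.sin (T + ε * ω₀ * T) := by rw [hS]; field_simp
  have hω_eq : ω₀ = -k / 2 * Real.cos (T + ε * ω₀ * T) := by rw [hC]; field_simp
  clear hS hC hsum hT hω₀
  rw [Real.sin_add] at hα_eq
  rw [Real.cos_add] at hω_eq
  have hexp : Complex.exp (-(Complex.I * (ω₀ : ℂ)) * (ε : ℂ) * (T : ℂ))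
      = (Real.cos (ε * ω₀ * T) : ℂ) - (Real.sin (ε * ω₀ * T) : ℂ) * Complex.I := by
    have harg : -(Complex.I * (ω₀ : ℂ)) * (ε : ℂ) * (T : ℂ)
        = ((-(ε * ω₀ * T) : ℝ) : ℂ) * Complex.I := by push_cast; ring
    rw [harg, Complex.exp_mul_I, ← Complex.ofReal_cos, ← Complex.ofReal_sin, Real.cos_neg,
      Real.sin_neg]
    push_cast; ring
  have hexp_two : Complex.exp (-2 * (Complex.I * (ω₀ : ℂ)) * (ε : ℂ) * (T : ℂ))
      = Complex.exp (-(Complex.I * (ω₀ : ℂ)) * (ε : ℂ) * (T : ℂ)) ^ 2 := by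
    rw [← Complex.exp_nat_mul]; congr 1; push_cast; ring
  have htwo : 2 * ε * ω₀ * T = 2 * (ε * ω₀ * T) := by ring
  rw [hexp_two, hexp, htwo, Real.cos_two_mul', Real.sin_two_mul]
  have hT_sq := Real.sin_sq_add_cos_sq T
  generalize Real.sin (ε * ω₀ * T) = p at *
  generalize Real.cos (ε * ω₀ * T) = q at *
  generalize Real.sin T = a at *
  generalize Real.cos T = b at *
  clear hexp hexp_two hden htwo hω_nonneg
  subst hα_eq hω_eq
  refine ⟨?_, ?_, ?_⟩
  · linear_combination (-4 * k ^ 2 * (q ^ 2 - p ^ 2)) * hT_sq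
  · linear_combination (8 * k ^ 2 * p * q) * hT_sq
  · have hfactor : -(Complex.I * ((-k / 2 * (b * q - a * p) : ℝ) : ℂ))
        - ((-k * (a * q + b * p) : ℝ) : ℂ) / 2 - (k : ℂ) / 2 * (q - p * Complex.I) * a
        = Complex.I * (k / 2 * (q - p * Complex.I) * b) := by
      push_cast
      linear_combination (k * b * p / 2 : ℂ) * Complex.I_sq
    rw [hfactor]
    linear_combination ((k : ℂ) / 2 * (q - p * Complex.I) * b) ^ 2 * Complex.I_sq
end

section
/- Let α, k, ε, T, ω be real numbers with k ≠ 0. If λ = iω satisfies the characteristic equation (−λ − α/2 − (k/2)e^{−λεT} sin T)² + (k²/4)e^{−2λεT} cos² T = 0, then 4ω² + α² = k²; in particular, if moreover ω ≥ 0 then ω = √(k² − α²)/2. -/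
/-- A complex root of `(z - c * sin T) ^ 2 + (c * cos T) ^ 2 = 0` has the same modulus as `c`. -/
lemma Complex.normSq_eq_of_sub_mul_sin_sq_add_eq_zero {z c : ℂ} {T : ℝ}
    (h : (z - c * (Real.sin T : ℂ)) ^ 2 + (c * (Real.cos T : ℂ)) ^ 2 = 0) :
    Complex.normSq z = Complex.normSq c := by
  have hfac : (z - c * (Real.sin T + Real.cos T * Complex.I)) *
      (z - c * (Real.sin T - Real.cos T * Complex.I)) = 0 := by
    linear_combination h - (c * (Real.cos T : ℂ)) ^ 2 * Complex.I_sq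
  have hT := Real.sin_sq_add_cos_sq T
  rcases mul_eq_zero.mp hfac with hz | hz <;> rw [sub_eq_zero.mp hz, Complex.normSq_mul]
  · rw [Complex.normSq_add_mul_I, hT, mul_one]
  · have : (Real.sin T : ℂ) - Real.cos T * Complex.I =
        (Real.sin T : ℂ) + ((-Real.cos T : ℝ) : ℂ) * Complex.I := by
      push_cast
      ring
    rw [this, Complex.normSq_add_mul_I, neg_sq, hT, mul_one]


/-- For the delayed Duffing slow flow (approach II): if `λ = iω` is a root of the
characteristic equation then `4ω² + α² = k²`; if moreover `ω ≥ 0` then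
`ω = √(k²−α²)/2`. -/
theorem stmt_5 (α k ε T ω : ℝ) (hk : k ≠ 0)
    (h : (-(Complex.I * (ω : ℂ)) - (α : ℂ)/2
        - (k : ℂ)/2 * Complex.exp (-(Complex.I * (ω : ℂ)) * (ε : ℂ) * (T : ℂ)) * (Real.sin T : ℂ))^2
      + (k : ℂ)^2/4 * Complex.exp (-2 * (Complex.I * (ω : ℂ)) * (ε : ℂ) * (T : ℂ)) * (Real.cos T : ℂ)^2
        = 0) :
    4*ω^2 + α^2 = k^2 ∧ (ω ≥ 0 → ω = Real.sqrt (k^2 - α^2) / 2) := by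
  have hE : Complex.exp (-2 * (Complex.I * (ω : ℂ)) * (ε : ℂ) * (T : ℂ)) =
      Complex.exp (-(Complex.I * (ω : ℂ)) * (ε : ℂ) * (T : ℂ)) ^ 2 := by
    rw [← Complex.exp_nat_mul]
    congr 1
    push_cast
    ring
  have hnorm : ‖Complex.exp (-(Complex.I * (ω : ℂ)) * (ε : ℂ) * (T : ℂ))‖ = 1 := by
    rw [Complex.norm_exp]
    simp
  rw [hE] at h
  set E := Complex.exp (-(Complex.I * (ω : ℂ)) * (ε : ℂ) * (T : ℂ))
  have hmod : Complex.normSq (((-α / 2 : ℝ) : ℂ) + ((-ω : ℝ) : ℂ) * Complex.I) =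
      Complex.normSq (((k / 2 : ℝ) : ℂ) * E) := by
    apply Complex.normSq_eq_of_sub_mul_sin_sq_add_eq_zero (T := T)
    rw [← h]
    push_cast
    ring
  rw [Complex.normSq_add_mul_I, Complex.normSq_mul, Complex.normSq_ofReal,
    Complex.normSq_eq_norm_sq, hnorm] at hmod
  have hmain : 4 * ω ^ 2 + α ^ 2 = k ^ 2 := by linear_combination 4 * hmod
  refine ⟨hmain, fun hω => ?_⟩
  rw [show k ^ 2 - α ^ 2 = (2 * ω) ^ 2 by linear_combination -hmain,
    Real.sqrt_sq (by positivity)]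
  ring
end

section
/- Let α, k, ε, T, ω be real numbers with k > 0. Then λ = iω satisfies the characteristic equation (−λ − α/2 − (k/2)e^{−λεT} sin T)² + (k²/4)e^{−2λεT} cos² T = 0 if and only if either [sin((1+εω)T) = −α/k and cos((1+εω)T) = −2ω/k] or [sin((1−εω)T) = −α/k and cos((1−εω)T) = 2ω/k]. -/
/-- Rotating `sin T + i cos T` by `exp (-iθ)` shifts the phase by `θ`. -/
lemma exp_neg_I_mul_sin_add_cos (T θ : ℝ) :
    Complex.exp (-(Complex.I * θ)) * (Real.sin T + Complex.I * Real.cos T)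
      = Real.sin (T + θ) + Complex.I * Real.cos (T + θ) := by
  rw [show -(Complex.I * (θ : ℂ)) = ((-θ : ℝ) : ℂ) * Complex.I by push_cast; ring,
    Complex.exp_mul_I, ← Complex.ofReal_cos, ← Complex.ofReal_sin, Real.cos_neg, Real.sin_neg,
    Real.sin_add, Real.cos_add]
  push_cast
  linear_combination (-(Complex.sin θ * Complex.cos T)) * Complex.I_sq

/-- Rotating `sin T - i cos T` by `exp (-iθ)` shifts the phase by `-θ`. -/
lemma exp_neg_I_mul_sin_sub_cos (T θ : ℝ) :
    Complex.exp (-(Complex.I * θ)) * (Real.sin T - Complex.I * Real.cos T)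
      = Real.sin (T - θ) - Complex.I * Real.cos (T - θ) := by
  rw [show -(Complex.I * (θ : ℂ)) = ((-θ : ℝ) : ℂ) * Complex.I by push_cast; ring,
    Complex.exp_mul_I, ← Complex.ofReal_cos, ← Complex.ofReal_sin, Real.cos_neg, Real.sin_neg,
    Real.sin_sub, Real.cos_sub]
  push_cast
  linear_combination (Complex.sin θ * Complex.cos T) * Complex.I_sq

/-- A complex linear factor vanishes iff its real and imaginary parts do. -/
lemma linear_factor_eq_zero_iff {k : ℝ} (hk : k ≠ 0) (α ω s c : ℝ) :
    -(Complex.I * (ω : ℂ)) - (α : ℂ) / 2 - (k : ℂ) / 2 * (s + Complex.I * c) = 0 ↔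
      s = -α / k ∧ c = -2 * ω / k := by
  rw [show -(Complex.I * (ω : ℂ)) - (α : ℂ) / 2 - (k : ℂ) / 2 * (s + Complex.I * c)
      = ((-α / 2 - k / 2 * s : ℝ) : ℂ) + ((-ω - k / 2 * c : ℝ) : ℂ) * Complex.I by
        push_cast; ring, Complex.ext_iff, eq_div_iff hk, eq_div_iff hk]
  simp only [Complex.add_re, Complex.add_im, Complex.re_ofReal_mul, Complex.im_ofReal_mul,
    Complex.ofReal_re, Complex.ofReal_im, Complex.I_re, Complex.I_im, Complex.zero_re,
    Complex.zero_im]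
  constructor <;> rintro ⟨h₁, h₂⟩ <;> constructor <;> linarith

/-- For the delayed Duffing slow flow (approach II) with `k > 0`, `λ = iω` is a
root of the characteristic equation iff one of two real trigonometric systems
holds; this follows from factoring the characteristic equation. -/
theorem stmt_6 (α k ε T ω : ℝ) (hk : k > 0) :
    ((-(Complex.I * (ω : ℂ)) - (α : ℂ)/2
        - (k : ℂ)/2 * Complex.exp (-(Complex.I * (ω : ℂ)) * (ε : ℂ) * (T : ℂ)) * (Real.sin T : ℂ))^2
      + (k : ℂ)^2/4 * Complex.exp (-2 * (Complex.I * (ω : ℂ)) * (ε : ℂ) * (T : ℂ)) * (Real.cos T : ℂ)^2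
        = 0) ↔
    ((Real.sin ((1 + ε*ω) * T) = -α/k ∧ Real.cos ((1 + ε*ω) * T) = -2*ω/k) ∨
     (Real.sin ((1 - ε*ω) * T) = -α/k ∧ Real.cos ((1 - ε*ω) * T) = 2*ω/k)) := by
  have hE : Complex.exp (-(Complex.I * (ω : ℂ)) * (ε : ℂ) * (T : ℂ))
      = Complex.exp (-(Complex.I * ((ε * ω * T : ℝ) : ℂ))) := by
    congr 1; push_cast; ring
  have hE2 : Complex.exp (-2 * (Complex.I * (ω : ℂ)) * (ε : ℂ) * (T : ℂ))
      = Complex.exp (-(Complex.I * ((ε * ω * T : ℝ) : ℂ))) ^ 2 := by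
    rw [← Complex.exp_nat_mul]
    congr 1; push_cast; ring
  have hplus := exp_neg_I_mul_sin_add_cos T (ε * ω * T)
  have hminus := exp_neg_I_mul_sin_sub_cos T (ε * ω * T)
  rw [show T + ε * ω * T = (1 + ε * ω) * T by ring] at hplus
  rw [show T - ε * ω * T = (1 - ε * ω) * T by ring] at hminus
  have hfactor (a κ E s c : ℂ) :
      (a - κ / 2 * E * s) ^ 2 + κ ^ 2 / 4 * E ^ 2 * c ^ 2
        = (a - κ / 2 * (E * (s + Complex.I * c))) * (a - κ / 2 * (E * (s - Complex.I * c))) := by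
    linear_combination (κ ^ 2 / 4 * E ^ 2 * c ^ 2) * Complex.I_sq
  rw [hE, hE2, hfactor, hplus, hminus, mul_eq_zero, linear_factor_eq_zero_iff hk.ne']
  refine or_congr Iff.rfl ?_
  have h := linear_factor_eq_zero_iff hk.ne' α ω (Real.sin ((1 - ε * ω) * T))
    (-Real.cos ((1 - ε * ω) * T))
  rw [Complex.ofReal_neg, mul_neg, ← sub_eq_add_neg] at h
  rw [h, neg_mul, neg_div k (2 * ω), neg_inj]
end

section
/- For all real numbers α, γ, k, R, θ, R_d, θ_d, T: (1/(2π))·∫₀^{2π} cos(t−θ)·(αR sin(t−θ) − γR³ cos³(t−θ) + k R_d cos(t−T−θ_d)) dt = −(3γ/8)R³ + (k/2) R_d cos(θ_d − θ + T). -/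
open Real in
/-- An antiderivative of the cosine projection of the perturbation. -/
lemma hasDerivAt_cos_projection (α γ k R θ Rd θd T t : ℝ) :
    HasDerivAt
      (fun t : ℝ => α * R * (sin (t - θ) ^ 2 / 2)
        - γ * R ^ 3 * (3 / 8 * t + 3 / 8 * (sin (t - θ) * cos (t - θ))
          + sin (t - θ) * cos (t - θ) ^ 3 / 4)
        + k * Rd / 2 * (t * cos (θd - θ + T)
          + (sin (t - θ) * cos (t - T - θd) + cos (t - θ) * sin (t - T - θd)) / 2))
      (cos (t - θ) * (α * R * sin (t - θ) - γ * R ^ 3 * cos (t - θ) ^ 3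
        + k * Rd * cos (t - T - θd))) t := by
  have hs : HasDerivAt (fun t : ℝ => sin (t - θ)) (cos (t - θ)) t := by
    simpa using ((hasDerivAt_id t).sub_const θ).sin
  have hc : HasDerivAt (fun t : ℝ => cos (t - θ)) (-sin (t - θ)) t := by
    simpa using ((hasDerivAt_id t).sub_const θ).cos
  have hs' : HasDerivAt (fun t : ℝ => sin (t - T - θd)) (cos (t - T - θd)) t := by
    simpa using (((hasDerivAt_id t).sub_const T).sub_const θd).sin
  have hc' : HasDerivAt (fun t : ℝ => cos (t - T - θd)) (-sin (t - T - θd)) t := by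
    simpa using (((hasDerivAt_id t).sub_const T).sub_const θd).cos
  have hphase : cos (θd - θ + T)
      = cos (t - θ) * cos (t - T - θd) + sin (t - θ) * sin (t - T - θd) := by
    rw [← cos_sub]
    congr 1
    ring
  have hsq : sin (t - θ) ^ 2 = 1 - cos (t - θ) ^ 2 := sin_sq _
  refine (((((hs.pow 2).div_const 2).const_mul (α * R)).sub
    (((((hasDerivAt_id t).const_mul (3 / 8)).add ((hs.mul hc).const_mul (3 / 8))).add
      ((hs.mul (hc.pow 3)).div_const 4)).const_mul (γ * R ^ 3))).add
    ((((hasDerivAt_id t).mul_const (cos (θd - θ + T))).add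
      (((hs.mul hc').add (hc.mul hs')).div_const 2)).const_mul (k * Rd / 2))).congr_deriv ?_
  simp only [Nat.cast_ofNat, Pi.pow_apply]
  rw [hphase]
  linear_combination (γ * R ^ 3 * (3 / 8 + 3 / 4 * cos (t - θ) ^ 2)) * hsq

open Real in
/-- Averaging computation for the phase equation of the delayed Duffing
slow flow. -/
theorem stmt_8 (α γ k R θ Rd θd T : ℝ) :
    (1 / (2 * π)) * ∫ t in (0:ℝ)..(2 * π),
        Real.cos (t - θ) *
          (α * R * Real.sin (t - θ) - γ * R^3 * (Real.cos (t - θ))^3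
            + k * Rd * Real.cos (t - T - θd))
      = -(3 * γ / 8) * R^3 + k/2 * Rd * Real.cos (θd - θ + T) := by
  rw [intervalIntegral.integral_eq_sub_of_hasDerivAt
    (fun t _ => hasDerivAt_cos_projection α γ k R θ Rd θd T t)
    (Continuous.intervalIntegrable (by fun_prop) _ _)]
  have shift (a : ℝ) : 2 * π - a = 0 - a + 2 * π := by ring
  have shift₂ : 2 * π - T - θd = 0 - T - θd + 2 * π := by ring
  rw [shift₂, shift θ]
  simp only [sin_add_two_pi, cos_add_two_pi]
  field_simp
  ring
end

section
/- Let k, ε be real numbers with k > 1, ε ≥ 0, set ω₀ = √(k² − 1)/2, and assume εω₀ < 1. Define T = arcsin(1/k)/(1 − εω₀). Then λ = iω₀ is a root of the characteristic equation (−λ + 1/2 − (k/2)e^{−λεT} sin T)² + (k²/4)e^{−2λεT} cos² T = 0. -/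
/-- The critical delay `T_cr₁ = arcsin(1/k)/(1 − εω₀)` of the delayed van der
Pol slow flow is an exact root of the characteristic equation at `λ = iω₀`,
where `ω₀ = √(k²−1)/2`. -/
theorem stmt_11 (k ε : ℝ) (hk : k > 1) (hε : ε ≥ 0)
    (ω₀ : ℝ) (hω₀ : ω₀ = Real.sqrt (k^2 - 1) / 2) (hεω : ε * ω₀ < 1)
    (T : ℝ) (hT : T = Real.arcsin (1/k) / (1 - ε * ω₀)) :
    (-(Complex.I * (ω₀ : ℂ)) + 1/2
        - (k : ℂ)/2 * Complex.exp (-(Complex.I * (ω₀ : ℂ)) * (ε : ℂ) * (T : ℂ)) * (Real.sin T : ℂ))^2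
      + (k : ℂ)^2/4 * Complex.exp (-2 * (Complex.I * (ω₀ : ℂ)) * (ε : ℂ) * (T : ℂ)) * (Real.cos T : ℂ)^2
        = 0 := by
  have hk0 : 0 < k := by linarith
  have hne : 1 - ε * ω₀ ≠ 0 := by linarith
  set a := Real.arcsin (1 / k) with ha
  have hinv : 1 / k ≤ 1 := by rw [div_le_one hk0]; exact hk.le
  have hs : k * Real.sin a = 1 := by
    rw [ha, Real.sin_arcsin (by linarith [one_div_pos.mpr hk0]) hinv]
    field_simp
  have hc : k * Real.cos a = 2 * ω₀ := by
    have hsq : 1 - (1 / k) ^ 2 = (k ^ 2 - 1) / k ^ 2 := by field_simp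
    rw [ha, Real.cos_arcsin, hsq, Real.sqrt_div' _ (sq_nonneg k), Real.sqrt_sq hk0.le, hω₀]
    field_simp
  have hphase : -(ω₀ * ε * T) + T = a := by
    have hmul : T * (1 - ε * ω₀) = a := by rw [hT, div_mul_cancel₀ _ hne]
    linear_combination hmul
  have hsC : (k : ℂ) * (Real.sin a : ℂ) = 1 := by exact_mod_cast hs
  have hcC : (k : ℂ) * (Real.cos a : ℂ) = 2 * (ω₀ : ℂ) := by exact_mod_cast hc
  have hexp : Complex.exp (-2 * (Complex.I * (ω₀ : ℂ)) * (ε : ℂ) * (T : ℂ))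
      = Complex.exp (-(Complex.I * (ω₀ : ℂ)) * (ε : ℂ) * (T : ℂ)) ^ 2 := by
    rw [← Complex.exp_nat_mul]
    congr 1
    push_cast
    ring
  have hrot : Complex.exp (-(Complex.I * (ω₀ : ℂ)) * (ε : ℂ) * (T : ℂ))
      * ((Real.cos T : ℂ) + (Real.sin T : ℂ) * Complex.I)
      = (Real.cos a : ℂ) + (Real.sin a : ℂ) * Complex.I := by
    simp only [Complex.ofReal_cos, Complex.ofReal_sin, ← Complex.exp_mul_I, ← Complex.exp_add]
    rw [← hphase]
    congr 1
    push_cast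
    ring
  rw [hexp]
  generalize Complex.exp (-(Complex.I * (ω₀ : ℂ)) * (ε : ℂ) * (T : ℂ)) = E at hrot ⊢
  have hroot : -(Complex.I * (ω₀ : ℂ)) + 1 / 2 - (k : ℂ) / 2 * E * (Real.sin T : ℂ)
      + Complex.I * ((k : ℂ) / 2 * E * (Real.cos T : ℂ)) = 0 := by
    linear_combination (Complex.I * (k : ℂ) / 2) * hrot - (1 / 2) * hsC
      + (Complex.I / 2) * hcC + ((k : ℂ) / 2 * ((Real.sin a : ℂ) - E * (Real.sin T : ℂ))) * Complex.I_sq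
  linear_combination (-(Complex.I * (ω₀ : ℂ)) + 1 / 2 - (k : ℂ) / 2 * E * (Real.sin T : ℂ)
      - Complex.I * ((k : ℂ) / 2 * E * (Real.cos T : ℂ))) * hroot
      + ((k : ℂ) / 2 * E * (Real.cos T : ℂ)) ^ 2 * Complex.I_sq
end

section
/- Let k, ε be real numbers with k > 1, ε ≥ 0, and set ω₀ = √(k² − 1)/2. Define T = (π − arcsin(1/k))/(1 + εω₀). Then λ = iω₀ is a root of the characteristic equation (−λ + 1/2 − (k/2)e^{−λεT} sin T)² + (k²/4)e^{−2λεT} cos² T = 0. -/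
/-- The critical delay `T_cr₂ = (π − arcsin(1/k))/(1 + εω₀)` of the delayed van
der Pol slow flow is an exact root of the characteristic equation at `λ = iω₀`,
where `ω₀ = √(k²−1)/2`. -/
theorem stmt_12 (k ε : ℝ) (hk : k > 1) (hε : ε ≥ 0)
    (ω₀ : ℝ) (hω₀ : ω₀ = Real.sqrt (k^2 - 1) / 2)
    (T : ℝ) (hT : T = (Real.pi - Real.arcsin (1/k)) / (1 + ε * ω₀)) :
    (-(Complex.I * (ω₀ : ℂ)) + 1/2
        - (k : ℂ)/2 * Complex.exp (-(Complex.I * (ω₀ : ℂ)) * (ε : ℂ) * (T : ℂ)) * (Real.sin T : ℂ))^2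
      + (k : ℂ)^2/4 * Complex.exp (-2 * (Complex.I * (ω₀ : ℂ)) * (ε : ℂ) * (T : ℂ)) * (Real.cos T : ℂ)^2
        = 0 := by
  have hk0 : k ≠ 0 := by positivity
  have hω : 0 ≤ ω₀ := by rw [hω₀]; positivity
  have hd : 1 + ε * ω₀ ≠ 0 := by positivity
  have hθ : T + ε * ω₀ * T = Real.pi - Real.arcsin (1 / k) := by
    rw [hT]; field_simp
  have hsin : Real.sin (T + ε * ω₀ * T) = 1 / k := by
    have h0 : 0 < 1 / k := by positivity
    have h1 : 1 / k ≤ 1 := by rw [div_le_one (by linarith)]; exact hk.le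
    rw [hθ, Real.sin_pi_sub, Real.sin_arcsin (by linarith) h1]
  have hcos : Real.cos (T + ε * ω₀ * T) = -(2 * ω₀ / k) := by
    have h : 1 - (1 / k) ^ 2 = (k ^ 2 - 1) / k ^ 2 := by field_simp
    rw [hθ, Real.cos_pi_sub, Real.cos_arcsin, h, Real.sqrt_div' _ (sq_nonneg k),
      Real.sqrt_sq (by linarith), hω₀]
    ring
  have hkC : (k : ℂ) ≠ 0 := by exact_mod_cast hk0
  have hexp : Complex.exp (-2 * (Complex.I * (ω₀ : ℂ)) * (ε : ℂ) * (T : ℂ))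
      = Complex.exp (-(Complex.I * (ω₀ : ℂ)) * (ε : ℂ) * (T : ℂ)) ^ 2 := by
    rw [← Complex.exp_nat_mul]; congr 1; push_cast; ring
  have hphase : (k : ℂ) * (Complex.exp (-(Complex.I * (ω₀ : ℂ)) * (ε : ℂ) * (T : ℂ))
      * ((Real.cos T : ℂ) - Complex.I * (Real.sin T : ℂ))) = -(2 * ω₀ + Complex.I) := by
    have hT' : (Real.cos T : ℂ) - Complex.I * (Real.sin T : ℂ)
        = Complex.exp (((-T : ℝ) : ℂ) * Complex.I) := by
      rw [Complex.exp_mul_I, ← Complex.ofReal_cos, ← Complex.ofReal_sin, Real.cos_neg,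
        Real.sin_neg]
      push_cast; ring
    have hsum : -(Complex.I * (ω₀ : ℂ)) * (ε : ℂ) * (T : ℂ) + ((-T : ℝ) : ℂ) * Complex.I
        = ((-(T + ε * ω₀ * T) : ℝ) : ℂ) * Complex.I := by
      push_cast; ring
    rw [hT', ← Complex.exp_add, hsum, Complex.exp_mul_I, ← Complex.ofReal_cos,
      ← Complex.ofReal_sin, Real.cos_neg, Real.sin_neg, hsin, hcos]
    push_cast
    field_simp
    ring
  rw [hexp]
  generalize Complex.exp (-(Complex.I * (ω₀ : ℂ)) * (ε : ℂ) * (T : ℂ)) = E at hphase ⊢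
  generalize (Real.cos T : ℂ) = c at hphase ⊢
  generalize (Real.sin T : ℂ) = s at hphase ⊢
  have hfactor : -(Complex.I * (ω₀ : ℂ)) + 1/2 - (k : ℂ)/2 * E * s
      - Complex.I * ((k : ℂ)/2 * E * c) = 0 := by
    linear_combination (-Complex.I / 2) * hphase
      + (-(k : ℂ) * E * s / 2 + 1 / 2) * Complex.I_sq
  linear_combination
    (-(Complex.I * (ω₀ : ℂ)) + 1/2 - (k : ℂ)/2 * E * s + Complex.I * ((k : ℂ)/2 * E * c))
      * hfactor + ((k : ℂ)/2 * E * c) ^ 2 * Complex.I_sq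
end

section
/- Let k, ε, T, ω be real numbers with k ≠ 0. If λ = iω satisfies the characteristic equation (−λ + 1/2 − (k/2)e^{−λεT} sin T)² + (k²/4)e^{−2λεT} cos² T = 0, then 4ω² + 1 = k²; in particular, if moreover ω ≥ 0 then ω = √(k² − 1)/2. -/
/-- For the delayed van der Pol slow flow (approach II): if `λ = iω` is a root
of the characteristic equation then `4ω² + 1 = k²`; if moreover `ω ≥ 0` then
`ω = √(k²−1)/2`. -/
theorem stmt_13 (k ε T ω : ℝ) (hk : k ≠ 0)
    (h : (-(Complex.I * (ω : ℂ)) + 1/2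
        - (k : ℂ)/2 * Complex.exp (-(Complex.I * (ω : ℂ)) * (ε : ℂ) * (T : ℂ)) * (Real.sin T : ℂ))^2
      + (k : ℂ)^2/4 * Complex.exp (-2 * (Complex.I * (ω : ℂ)) * (ε : ℂ) * (T : ℂ)) * (Real.cos T : ℂ)^2
        = 0) :
    4*ω^2 + 1 = k^2 ∧ (ω ≥ 0 → ω = Real.sqrt (k^2 - 1) / 2) := by
  obtain ⟨E, hE, hE1⟩ : ∃ E : ℂ, Complex.exp (-(Complex.I * (ω : ℂ)) * (ε : ℂ) * (T : ℂ)) = E ∧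
      Complex.normSq E = 1 := by
    refine ⟨_, rfl, ?_⟩
    have hθ : -(Complex.I * (ω : ℂ)) * (ε : ℂ) * (T : ℂ)
        = ((-(ω * ε * T) : ℝ) : ℂ) * Complex.I := by
      push_cast; ring
    rw [hθ, Complex.normSq_eq_norm_sq, Complex.norm_exp_ofReal_mul_I, one_pow]
  have hE2 : Complex.exp (-2 * (Complex.I * (ω : ℂ)) * (ε : ℂ) * (T : ℂ)) = E ^ 2 := by
    rw [← hE, ← Complex.exp_nat_mul]
    congr 1
    push_cast
    ring
  rw [hE, hE2] at h
  have hmod : ∀ c : ℝ, c ^ 2 = Real.cos T ^ 2 →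
      -(Complex.I * (ω : ℂ)) + 1/2 = ((k / 2 : ℝ) : ℂ) * E * (Real.sin T + c * Complex.I) →
      4 * ω ^ 2 + 1 = k ^ 2 := by
    intro c hc hA
    have hA' : -(Complex.I * (ω : ℂ)) + 1/2 = ((1/2 : ℝ) : ℂ) + ((-ω : ℝ) : ℂ) * Complex.I := by
      push_cast; ring
    have hn := congrArg Complex.normSq hA
    rw [hA', map_mul, map_mul, Complex.normSq_add_mul_I, Complex.normSq_add_mul_I,
      Complex.normSq_ofReal, hE1, hc, Real.sin_sq_add_cos_sq] at hn
    linarith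
  have hmain : 4 * ω ^ 2 + 1 = k ^ 2 := by
    have hfac : (-(Complex.I * (ω : ℂ)) + 1/2
          - ((k / 2 : ℝ) : ℂ) * E * (Real.sin T + (Real.cos T : ℝ) * Complex.I)) *
        (-(Complex.I * (ω : ℂ)) + 1/2
          - ((k / 2 : ℝ) : ℂ) * E * (Real.sin T + (-Real.cos T : ℝ) * Complex.I)) = 0 := by
      rw [← h]
      push_cast
      linear_combination (-(k : ℂ) ^ 2 / 4 * E ^ 2 * Complex.cos T ^ 2) * Complex.I_sq
    rcases mul_eq_zero.mp hfac with h1 | h1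
    · exact hmod _ rfl (sub_eq_zero.mp h1)
    · exact hmod _ (neg_sq _) (sub_eq_zero.mp h1)
  refine ⟨hmain, fun hω => ?_⟩
  rw [show k ^ 2 - 1 = (2 * ω) ^ 2 by linarith, Real.sqrt_sq (by linarith)]
  ring
end

section
/- For all real numbers k, R, θ, R_d, θ_d, T: (1/(2π))·∫₀^{2π} (−sin(t−θ))·(−R sin(t−θ)·(1 − R² cos²(t−θ)) + k R_d cos(t−T−θ_d)) dt = R/2 − R³/8 − (k/2) R_d sin(θ_d − θ + T). -/
open Real in
/-- An antiderivative of the integrand, obtained by linearizing the trigonometric products. -/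
theorem hasDerivAt_delayed_vdp_amplitude (k R θ Rd θd T t : ℝ) :
    HasDerivAt (fun t : ℝ => R * (t / 2 - sin (2 * (t - θ)) / 4)
        - R^3 * (t / 8 - sin (4 * (t - θ)) / 32)
        + k * Rd / 2 * (cos (2 * t - θ - T - θd) / 2 - t * sin (θd - θ + T)))
      ((-sin (t - θ)) * (-R * sin (t - θ) * (1 - R^2 * (cos (t - θ))^2)
        + k * Rd * cos (t - T - θd))) t := by
  have hid : HasDerivAt (fun t : ℝ => t) 1 t := hasDerivAt_id t
  have h2 := ((hid.sub_const θ).const_mul 2).sin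
  have h4 := ((hid.sub_const θ).const_mul 4).sin
  have hc := ((((hid.const_mul 2).sub_const θ).sub_const T).sub_const θd).cos
  refine (((((hid.div_const 2).sub (h2.div_const 4)).const_mul R).sub
    (((hid.div_const 8).sub (h4.div_const 32)).const_mul (R^3))).add
    (((hc.div_const 2).sub (hid.mul_const (sin (θd - θ + T)))).const_mul
      (k * Rd / 2))).congr_deriv ?_
  have e4 : cos (4 * (t - θ)) = 2 * (2 * cos (t - θ) ^ 2 - 1) ^ 2 - 1 := by
    rw [← cos_two_mul, ← cos_two_mul]; ring_nf
  have es : sin (2 * t - θ - T - θd)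
      = sin (t - θ) * cos (t - T - θd) + cos (t - θ) * sin (t - T - θd) := by
    rw [← sin_add]; ring_nf
  have ed : sin (θd - θ + T)
      = sin (t - θ) * cos (t - T - θd) - cos (t - θ) * sin (t - T - θd) := by
    rw [← sin_sub]; ring_nf
  rw [e4, cos_two_mul, es, ed]
  linear_combination (-R + R^3 * cos (t - θ) ^ 2) * sin_sq_add_cos_sq (t - θ)

open Real in
/-- Averaging computation for the amplitude equation of the delayed van der Pol
slow flow. -/
theorem stmt_15 (k R θ Rd θd T : ℝ) :
    (1 / (2 * π)) * ∫ t in (0:ℝ)..(2 * π),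
        (-Real.sin (t - θ)) *
          (-R * Real.sin (t - θ) * (1 - R^2 * (Real.cos (t - θ))^2)
            + k * Rd * Real.cos (t - T - θd))
      = R / 2 - R^3 / 8 - k/2 * Rd * Real.sin (θd - θ + T) := by
  rw [intervalIntegral.integral_eq_sub_of_hasDerivAt
    (fun t _ => hasDerivAt_delayed_vdp_amplitude k R θ Rd θd T t)
    (Continuous.intervalIntegrable (by fun_prop) _ _)]
  have p2 : sin (2 * (2 * π - θ)) = sin (2 * (0 - θ)) := by
    rw [← sin_add_nat_mul_two_pi (2 * (0 - θ)) 2]; push_cast; ring_nf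
  have p4 : sin (4 * (2 * π - θ)) = sin (4 * (0 - θ)) := by
    rw [← sin_add_nat_mul_two_pi (4 * (0 - θ)) 4]; push_cast; ring_nf
  have pc : cos (2 * (2 * π) - θ - T - θd) = cos (2 * 0 - θ - T - θd) := by
    rw [← cos_add_nat_mul_two_pi (2 * 0 - θ - T - θd) 2]; push_cast; ring_nf
  rw [p2, p4, pc]
  field_simp
  ring
end
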